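/- The left adjoint c of the ordinary nerve functor N : Cat → sSet preserves finite products: for any simplicial sets X and Y there is a natural isomorphism c(X × Y) ≅ c(X) × c(Y). -/

import Mathlib

open CategoryTheory Limits

universe u

theorem nerve_left_adjoint_preserves_finite_products
    (c : SSet.{u} ⥤ Cat.{u, u}) (adj : c ⊣ nerveFunctor.{u, u}) :
    Nonempty (PreservesFiniteProducts c) ∧
      ∀ X Y : SSet.{u},
        Nonempty (c.obj (X ⨯ Y) ≅ Cat.of (↑(c.obj X) × ↑(c.obj Y))) := by
  have e : SSet.hoFunctor.{u} ≅ c := nerveAdjunction.leftAdjointUniq adj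
  have h : PreservesFiniteProducts c :=
    ⟨fun n => preservesLimitsOfShape_of_natIso e⟩
  refine ⟨⟨h⟩, fun X Y => ⟨?_⟩⟩
  exact PreservesLimitPair.iso c X Y ≪≫
    (prodIsProd (c.obj X) (c.obj Y)).conePointUniqueUpToIso
      (CartesianMonoidalCategory.tensorProductIsBinaryProduct (c.obj X) (c.obj Y))
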